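/- For all sufficiently large n and any k with 1 ≤ k ≤ 2^{(log n)^{1/4}}, there exists a (p, q, k)-disjoint-unique-paths graph on n vertices with p ≥ n / exp(η_p · (ln n)^{3/4}) and q ≥ n / exp(η_q · (ln n)^{3/4}), for absolute constants η_p, η_q > 0. -/

import Mathlib

/-- A `(p,q,k)`-disjoint-unique-paths (DUP) graph structure on a vertex type `V`:
a simple graph whose vertices are partitioned into `k+1` layers (via `layer`), with
edges only between consecutive layers (so each layer is an independent set), whose edge
set is partitioned into `q` unique path collections (UPCs) `𝒫 i = {P i j | j ∈ [p]}`,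
each consisting of `p` vertex-disjoint layered paths (one vertex per layer, edges
between consecutive layers), such that any layered path of the whole graph from a
start-vertex of `𝒫 i` to a final-vertex of `𝒫 i` is a path of `𝒫 i`. -/
structure IsDUPGraph {V : Type*} (G : SimpleGraph V) (layer : V → Fin (k + 1))
    (P : Fin q → Fin p → Fin (k + 1) → V) : Prop where
  strict : ∀ u v, G.Adj u v →
    ((layer v : ℕ) = (layer u : ℕ) + 1 ∨ (layer u : ℕ) = (layer v : ℕ) + 1)
  layerP : ∀ i j ℓ, layer (P i j ℓ) = ℓ
  path_adj : ∀ i j (ℓ : Fin k), G.Adj (P i j ℓ.castSucc) (P i j ℓ.succ)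
  vdisj : ∀ i j j' ℓ ℓ', P i j ℓ = P i j' ℓ' → j = j'
  unique : ∀ i (R : Fin (k + 1) → V), (∀ ℓ, layer (R ℓ) = ℓ) →
    (∀ ℓ : Fin k, G.Adj (R ℓ.castSucc) (R ℓ.succ)) →
    (∃ j, R 0 = P i j 0) → (∃ j, R (Fin.last k) = P i j (Fin.last k)) →
    ∃ j, R = P i j
  partition : ∀ u v, G.Adj u v → ∃! ij : Fin q × Fin p, ∃ ℓ : Fin k,
    (u = P ij.1 ij.2 ℓ.castSucc ∧ v = P ij.1 ij.2 ℓ.succ) ∨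
    (v = P ij.1 ij.2 ℓ.castSucc ∧ u = P ij.1 ij.2 ℓ.succ)

/-- Integer vectors on a common sphere are average-free. -/
theorem eq_of_sum_eq_card_mul_of_sphere {ι κ : Type*} [Fintype ι] [Fintype κ] {r : ℤ}
    (z : κ → ι → ℤ) (w : ι → ℤ) (hz : ∀ t, ∑ c, z t c ^ 2 = r) (hw : ∑ c, w c ^ 2 = r)
    (hsum : ∀ c, ∑ t, z t c = Fintype.card κ * w c) (t : κ) : z t = w := by
  have key : ∑ t, ∑ c, (z t c - w c) ^ 2 = 0 := by
    have h1 : ∀ t, ∑ c, (z t c - w c) ^ 2 = 2 * r - 2 * ∑ c, w c * z t c := by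
      intro t
      have : ∀ c, (z t c - w c) ^ 2 = z t c ^ 2 + w c ^ 2 - 2 * (w c * z t c) := by
        intro c
        ring
      simp only [this, Finset.sum_sub_distrib, Finset.sum_add_distrib, hz, hw, ← Finset.mul_sum]
      ring
    have h2 : ∑ t, ∑ c, w c * z t c = Fintype.card κ * r := by
      rw [Finset.sum_comm]
      simp only [← Finset.mul_sum, hsum]
      rw [← hw, Finset.mul_sum]
      exact Finset.sum_congr rfl fun c _ ↦ by ring
    simp only [h1, Finset.sum_sub_distrib, ← Finset.mul_sum, h2]
    simp
  have h3 := (Finset.sum_eq_zero_iff_of_nonneg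
    (fun t _ ↦ Finset.sum_nonneg fun c _ ↦ sq_nonneg (z t c - w c))).1 key t (Finset.mem_univ t)
  have h4 := (Finset.sum_eq_zero_iff_of_nonneg (fun c _ ↦ sq_nonneg (z t c - w c))).1 h3
  funext c
  have := h4 c (Finset.mem_univ c)
  exact sub_eq_zero.1 (pow_eq_zero_iff two_ne_zero |>.1 this)

/-- The graph formed by all edges of a family of layered paths. -/
def pathFamilyGraph {V : Type*} {k p q : ℕ} (layer : V → Fin (k + 1))
    (P : Fin q → Fin p → Fin (k + 1) → V) (hP : ∀ i j t, layer (P i j t) = t) :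
    SimpleGraph V where
  Adj u v := ∃ i j, ∃ t : Fin k, (u = P i j t.castSucc ∧ v = P i j t.succ) ∨
    (v = P i j t.castSucc ∧ u = P i j t.succ)
  symm := ⟨by
    rintro u v ⟨i, j, t, h⟩
    exact ⟨i, j, t, h.symm⟩⟩
  loopless := ⟨by
    rintro u ⟨i, j, t, ⟨h, h'⟩ | ⟨h, h'⟩⟩ <;>
    · have := congrArg layer (h.symm.trans h')
      rw [hP, hP] at this
      exact t.castSucc_lt_succ.ne this⟩

/-- A family of arithmetic progressions whose differences lie on a sphere is a DUP graph. -/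
theorem isDUPGraph_pathFamilyGraph {V ι : Type*} [Fintype ι] {k p q : ℕ} {r : ℤ}
    (layer : V → Fin (k + 1)) (P : Fin q → Fin p → Fin (k + 1) → V)
    (hP : ∀ i j t, layer (P i j t) = t) (pos : V → ι → ℤ) (X : Fin q → ι → ℤ)
    (Y : Fin p → ι → ℤ) (hX : Function.Injective X) (hY : Function.Injective Y)
    (hr : ∀ j, ∑ c, Y j c ^ 2 = r)
    (hpos : ∀ i j t c, pos (P i j t) c = X i c + ((t : ℕ) + 1) * Y j c) :
    IsDUPGraph (pathFamilyGraph layer P hP) layer P where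
  strict := by
    rintro u v ⟨i, j, t, ⟨rfl, rfl⟩ | ⟨rfl, rfl⟩⟩ <;> simp [hP]
  layerP := hP
  path_adj i j t := ⟨i, j, t, Or.inl ⟨rfl, rfl⟩⟩
  vdisj i j j' t t' h := by
    have ht : t = t' := by simpa [hP] using congrArg layer h
    subst ht
    apply hY
    funext c
    have := congrFun (congrArg pos h) c
    rw [hpos, hpos] at this
    exact mul_left_cancel₀ (by positivity) (add_left_cancel this)
  unique := by
    rintro i R hR hadj ⟨j₀, h0⟩ ⟨j₁, h1⟩
    have step : ∀ t : Fin k, ∃ i' j', R t.castSucc = P i' j' t.castSucc ∧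
        R t.succ = P i' j' t.succ := by
      intro t
      obtain ⟨i', j', t', ⟨h, h'⟩ | ⟨h, h'⟩⟩ := hadj t
      · have ht := congrArg layer h
        rw [hR, hP, Fin.castSucc_inj] at ht
        subst ht
        exact ⟨i', j', h, h'⟩
      · have ht := congrArg layer h
        have ht' := congrArg layer h'
        rw [hR, hP] at ht ht'
        simp only [Fin.ext_iff, Fin.val_succ, Fin.val_castSucc] at ht ht'
        omega
    choose I J hc hs using step
    have hdiff : ∀ t c, pos (R (Fin.succ t)) c = pos (R t.castSucc) c + Y (J t) c := by
      intro t c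
      rw [hc, hs, hpos, hpos]
      simp
      ring
    have htel : ∀ (m : ℕ) (hm : m ≤ k) c, pos (R ⟨m, by omega⟩) c =
        pos (R 0) c + ∑ t : Fin m, Y (J (Fin.castLE hm t)) c := by
      intro m
      induction m with
      | zero => simp
      | succ m ih =>
        intro hm c
        have := hdiff ⟨m, by omega⟩ c
        rw [Fin.sum_univ_castSucc, ← add_assoc]
        exact this.trans (congrArg₂ (· + ·) (ih (by omega) c) rfl)
    let z : Fin (k + 1) → ι → ℤ := Fin.cons (Y j₀) fun t ↦ Y (J t)
    have hz := eq_of_sum_eq_card_mul_of_sphere (r := r) z (Y j₁)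
      (by
        intro t
        refine Fin.cases ?_ (fun t ↦ ?_) t <;> simp [z, hr])
      (hr j₁)
      (by
        intro c
        have h2 := htel k le_rfl c
        have h3 : pos (R (Fin.last k)) c = _ := congrFun (congrArg pos h1) c
        have h4 : pos (R 0) c = _ := congrFun (congrArg pos h0) c
        rw [hpos] at h3 h4
        change pos (R (Fin.last k)) c = _ at h2
        rw [h3, h4] at h2
        simp only [Fin.castLE_rfl, id_eq, Fin.val_last, Fin.val_zero] at h2
        simp only [Fin.sum_univ_succ, z, Fin.cons_zero, Fin.cons_succ, Fintype.card_fin]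
        push_cast at h2 ⊢
        linarith)
    have hj0 : j₀ = j₁ := hY (hz 0)
    have hJ : ∀ t, J t = j₁ := fun t ↦ hY (hz t.succ)
    refine ⟨j₁, funext fun t ↦ ?_⟩
    induction t using Fin.induction with
    | zero => rw [h0, hj0]
    | succ t ih =>
      have hi : I t = i := by
        apply hX
        funext c
        have := congrFun (congrArg pos ((hc t).symm.trans ih)) c
        rw [hpos, hpos, hJ] at this
        exact add_right_cancel this
      rw [hs, hi, hJ]
  partition := by
    have huniq : ∀ i j i' j' (t t' : Fin k), P i j t.castSucc = P i' j' t'.castSucc →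
        P i j t.succ = P i' j' t'.succ → i' = i ∧ j' = j := by
      intro i j i' j' t t' h h'
      have ht := congrArg layer h
      rw [hP, hP, Fin.castSucc_inj] at ht
      subst ht
      have hc := fun c ↦ congrFun (congrArg pos h) c
      have hs := fun c ↦ congrFun (congrArg pos h') c
      simp only [hpos, Fin.val_castSucc, Fin.val_succ, Nat.cast_add, Nat.cast_one] at hc hs
      have hj : j' = j := hY (funext fun c ↦ by linarith [hc c, hs c])
      subst hj
      exact ⟨hX (funext fun c ↦ by linarith [hc c]), rfl⟩
    have hcross : ∀ i j i' j' (t t' : Fin k), P i j t.castSucc = P i' j' t'.succ →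
        P i j t.succ = P i' j' t'.castSucc → False := by
      intro i j i' j' t t' h h'
      have ht := congrArg layer h
      have ht' := congrArg layer h'
      rw [hP, hP] at ht ht'
      simp only [Fin.ext_iff, Fin.val_succ, Fin.val_castSucc] at ht ht'
      omega
    rintro u v ⟨i, j, t, h⟩
    refine ⟨(i, j), ⟨t, h⟩, ?_⟩
    rintro ⟨i', j'⟩ ⟨t', h'⟩
    rw [Prod.mk.injEq]
    dsimp only at h'
    rcases h with ⟨rfl, rfl⟩ | ⟨rfl, rfl⟩ <;> rcases h' with ⟨hu, hv⟩ | ⟨hu, hv⟩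
    · exact huniq _ _ _ _ _ _ hu hv
    · exact (hcross _ _ _ _ _ _ hv hu).elim
    · exact (hcross _ _ _ _ _ _ hv hu).elim
    · exact huniq _ _ _ _ _ _ hu hv

/-- Some sphere contains at least a `1 / (d l ^ 2)` proportion of the grid `[l] ^ d`. -/
theorem exists_sphere_card_ge {d l : ℕ} (hd : 0 < d) (hl : 0 < l) :
    ∃ r : ℕ, (l : ℝ) ^ d / (d * l ^ 2) ≤
      (Finset.univ.filter fun y : Fin d → Fin l ↦ ∑ c, (y c : ℕ) ^ 2 = r).card := by
  have hdl : (0 : ℝ) < d * l ^ 2 := by positivity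
  obtain ⟨r, -, hr⟩ := Finset.exists_le_card_fiber_of_nsmul_le_card_of_maps_to
    (s := (Finset.univ : Finset (Fin d → Fin l))) (t := Finset.range (d * l ^ 2))
    (f := fun y ↦ ∑ c, (y c : ℕ) ^ 2) (b := (l : ℝ) ^ d / (d * l ^ 2))
    (by
      intro y _
      have : Nonempty (Fin d) := ⟨⟨0, hd⟩⟩
      rw [Finset.mem_range]
      calc ∑ c, (y c : ℕ) ^ 2 < ∑ _c : Fin d, l ^ 2 :=
            Finset.sum_lt_sum_of_nonempty Finset.univ_nonempty fun c _ ↦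
              Nat.pow_lt_pow_left (y c).isLt two_ne_zero
        _ = d * l ^ 2 := by simp)
    (by
      rw [Finset.nonempty_range_iff]
      positivity)
    (by
      simp only [Finset.card_range, nsmul_eq_mul, Finset.card_univ, Fintype.card_fun,
        Fintype.card_fin]
      push_cast
      rw [mul_div_cancel₀ _ hdl.ne'])
  exact ⟨r, hr⟩

/-- The high-dimensional grid construction of DUP graphs. -/
theorem exists_isDUPGraph_of_grid {n k d l : ℕ} (hd : 0 < d) (hl : 0 < l)
    (hn : (k + 1) * ((k + 2) * l) ^ d ≤ n) :
    ∃ p : ℕ, ∃ G : SimpleGraph (Fin n), ∃ layer : Fin n → Fin (k + 1),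
      ∃ P : Fin (l ^ d) → Fin p → Fin (k + 1) → Fin n,
        IsDUPGraph G layer P ∧ (l : ℝ) ^ d / (d * l ^ 2) ≤ p := by
  obtain ⟨r, hr⟩ := exists_sphere_card_ge hd hl
  set A := Finset.univ.filter fun y : Fin d → Fin l ↦ ∑ c, (y c : ℕ) ^ 2 = r
  have hM : 0 < (k + 2) * l := by positivity
  have : Nonempty (Fin (k + 1) × (Fin d → Fin ((k + 2) * l))) := ⟨(0, fun _ ↦ ⟨0, hM⟩)⟩
  obtain ⟨e⟩ : Nonempty (Fin (k + 1) × (Fin d → Fin ((k + 2) * l)) ↪ Fin n) := by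
    apply Function.Embedding.nonempty_of_card_le
    simpa using hn
  have he : ∀ w, Function.invFun e (e w) = w := Function.leftInverse_invFun e.injective
  let X : Fin (l ^ d) ≃ (Fin d → Fin l) := (Fintype.equivFinOfCardEq (by simp)).symm
  let Y : Fin A.card ≃ A := A.equivFin.symm
  have hlt : ∀ i j (t : Fin (k + 1)) c,
      (X i c : ℕ) + ((t : ℕ) + 1) * ((Y j).1 c : ℕ) < (k + 2) * l := by
    intro i j t c
    have h1 := (X i c).isLt
    have h2 : ((t : ℕ) + 1) * ((Y j).1 c : ℕ) ≤ (k + 1) * l :=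
      Nat.mul_le_mul (by omega) ((Y j).1 c).isLt.le
    linarith
  let P : Fin (l ^ d) → Fin A.card → Fin (k + 1) → Fin n :=
    fun i j t ↦ e (t, fun c ↦ ⟨_, hlt i j t c⟩)
  have hP : ∀ i j t, (Function.invFun e (P i j t)).1 = t := fun i j t ↦ by simp only [P, he]
  refine ⟨A.card, pathFamilyGraph (fun v ↦ (Function.invFun e v).1) P hP,
    fun v ↦ (Function.invFun e v).1, P, ?_, hr⟩
  refine isDUPGraph_pathFamilyGraph (r := r) _ P hP
    (fun v c ↦ ((Function.invFun e v).2 c : ℕ)) (fun i c ↦ ((X i c : ℕ) : ℤ))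
    (fun j c ↦ (((Y j).1 c : ℕ) : ℤ)) ?_ ?_ ?_ ?_
  · intro i i' h
    apply X.injective
    funext c
    exact Fin.ext (Int.ofNat_inj.1 (congrFun h c))
  · intro j j' h
    apply Y.injective
    apply Subtype.ext
    funext c
    exact Fin.ext (Int.ofNat_inj.1 (congrFun h c))
  · intro j
    have := (Finset.mem_filter.1 (Y j).2).2
    exact_mod_cast this
  · intro i j t c
    simp only [P, he]
    push_cast
    rfl

/-- The largest side length `l` for which the grid construction fits into `n` vertices. -/
theorem exists_grid_side {n a b d : ℕ} (hd : 0 < d) (ha : 0 < a) (hb : 0 < b)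
    (h : a * b ^ d ≤ n) :
    ∃ l : ℕ, 0 < l ∧ a * (b * l) ^ d ≤ n ∧ n ≤ a * (2 * b) ^ d * l ^ d := by
  have hbound : ∀ l, a * (b * l) ^ d ≤ n → l ≤ n := fun l hl ↦
    calc l ≤ b * l := Nat.le_mul_of_pos_left _ hb
      _ ≤ (b * l) ^ d := Nat.le_self_pow hd.ne' _
      _ ≤ a * (b * l) ^ d := Nat.le_mul_of_pos_left _ ha
      _ ≤ n := hl
  have h1 : a * (b * 1) ^ d ≤ n := by simpa using h
  set l := Nat.findGreatest (fun l ↦ a * (b * l) ^ d ≤ n) n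
  have hpos : 0 < l := Nat.le_findGreatest (hbound 1 h1) h1
  refine ⟨l, hpos, Nat.findGreatest_spec (P := fun l ↦ a * (b * l) ^ d ≤ n) (hbound 1 h1) h1, ?_⟩
  by_contra! hlt
  have h2 : a * (b * (l + 1)) ^ d ≤ n := by
    refine le_trans ?_ hlt.le
    rw [mul_assoc, ← mul_pow]
    gcongr a * ?_ ^ d
    nlinarith
  have := Nat.le_findGreatest (P := fun l ↦ a * (b * l) ^ d ≤ n) (hbound _ h2) h2
  omega

/-- Quantitative form of the grid construction, in terms of `s = (log n) ^ (1 / 4)`. -/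
theorem exists_isDUPGraph_of_log_eq {n k : ℕ} {s : ℝ} (hs : 12 ≤ s) (hn : 0 < n)
    (hsn : Real.log n = s ^ 4) (hk : (k : ℝ) ≤ Real.exp s) :
    ∃ p q : ℕ, ∃ G : SimpleGraph (Fin n), ∃ layer : Fin n → Fin (k + 1),
      ∃ P : Fin q → Fin p → Fin (k + 1) → Fin n,
        IsDUPGraph G layer P ∧
        (n : ℝ) / Real.exp (16 * s ^ 3) ≤ p ∧ (n : ℝ) / Real.exp (16 * s ^ 3) ≤ q := by
  have hn' : (0 : ℝ) < n := by exact_mod_cast hn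
  have hn_exp : (n : ℝ) = Real.exp (s ^ 4) := by rw [← hsn, Real.exp_log hn']
  obtain ⟨d, hd⟩ : ∃ d, d = ⌈s ^ 2⌉₊ := ⟨_, rfl⟩
  have hd1 : s ^ 2 ≤ d := hd ▸ Nat.le_ceil _
  have hd2 : (d : ℝ) ≤ s ^ 2 + 1 := hd ▸ (Nat.ceil_lt_add_one (sq_nonneg s)).le
  have hd0' : (0 : ℝ) < d := by nlinarith
  have hd0 : 0 < d := by exact_mod_cast hd0'
  have he1 : (1 : ℝ) ≤ Real.exp s := Real.one_le_exp (by linarith)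
  have he3 : (8 : ℝ) ≤ Real.exp 3 := by
    have h := Real.add_one_le_exp (1 : ℝ)
    have h3 : Real.exp 3 = Real.exp 1 ^ 3 := by rw [← Real.exp_nat_mul]; norm_num
    rw [h3]
    calc (8 : ℝ) = 2 ^ 3 := by norm_num
      _ ≤ Real.exp 1 ^ 3 := by gcongr; linarith
  have hk2 : (2 : ℝ) * (k + 2) ≤ Real.exp (s + 3) := by
    rw [Real.exp_add]
    nlinarith
  have hloss : ((k : ℝ) + 1) * (2 * (k + 2)) ^ d ≤ Real.exp (12 * s ^ 3) :=
    calc ((k : ℝ) + 1) * (2 * (k + 2)) ^ d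
        ≤ Real.exp (s + 3) * Real.exp (s + 3) ^ d := by
          gcongr
          have : (0 : ℝ) ≤ k := k.cast_nonneg
          linarith
      _ = Real.exp ((d + 1) * (s + 3)) := by
          rw [← Real.exp_nat_mul, ← Real.exp_add]
          ring_nf
      _ ≤ Real.exp (12 * s ^ 3) := by
          apply Real.exp_le_exp.2
          calc ((d : ℝ) + 1) * (s + 3) ≤ (2 * s ^ 2) * (2 * s) := by
                gcongr <;> nlinarith
            _ ≤ 12 * s ^ 3 := by
                have : 0 ≤ s ^ 3 := by positivity
                linarith
  have hfit : (k + 1) * (k + 2) ^ d ≤ n := by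
    have : ((k : ℝ) + 1) * (k + 2) ^ d ≤ n :=
      calc ((k : ℝ) + 1) * (k + 2) ^ d ≤ (k + 1) * (2 * (k + 2)) ^ d := by
            gcongr
            have : (0 : ℝ) ≤ k := k.cast_nonneg
            linarith
        _ ≤ Real.exp (12 * s ^ 3) := hloss
        _ ≤ n := by
            rw [hn_exp]
            apply Real.exp_le_exp.2
            calc 12 * s ^ 3 ≤ s * s ^ 3 := by gcongr
              _ = s ^ 4 := by ring
    exact_mod_cast this
  obtain ⟨l, hl, hle, hge⟩ := exists_grid_side hd0 (by omega) (by omega) hfit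
  obtain ⟨p, G, layer, P, hG, hp⟩ := exists_isDUPGraph_of_grid hd0 hl hle
  have hl' : (0 : ℝ) < l := by exact_mod_cast hl
  have hld : (n : ℝ) / Real.exp (12 * s ^ 3) ≤ (l : ℝ) ^ d := by
    rw [div_le_iff₀' (Real.exp_pos _)]
    have : (n : ℝ) ≤ (k + 1) * (2 * (k + 2)) ^ d * l ^ d := by exact_mod_cast hge
    exact this.trans (by gcongr)
  have hl_exp : (l : ℝ) ≤ Real.exp (s ^ 2) := by
    have h1 : l ^ d ≤ n :=
      calc l ^ d ≤ ((k + 2) * l) ^ d := by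
            gcongr
            exact Nat.le_mul_of_pos_left _ (by omega)
        _ ≤ (k + 1) * ((k + 2) * l) ^ d := Nat.le_mul_of_pos_left _ (by omega)
        _ ≤ n := hle
    have h2 : (l : ℝ) ^ d ≤ Real.exp (s ^ 2) ^ d :=
      calc (l : ℝ) ^ d ≤ n := by exact_mod_cast h1
        _ = Real.exp (s ^ 2 * s ^ 2) := by
            rw [hn_exp]
            ring_nf
        _ ≤ Real.exp (d * s ^ 2) := by gcongr
        _ = Real.exp (s ^ 2) ^ d := Real.exp_nat_mul _ _
    exact le_of_pow_le_pow_left₀ hd0.ne' (Real.exp_pos _).le h2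
  have hdl : (d : ℝ) * l ^ 2 ≤ Real.exp (4 * s ^ 3) :=
    calc (d : ℝ) * l ^ 2 ≤ Real.exp (s ^ 2) * Real.exp (s ^ 2) ^ 2 := by
          gcongr
          exact hd2.trans (Real.add_one_le_exp _)
      _ = Real.exp (3 * s ^ 2) := by
          rw [← Real.exp_nat_mul, ← Real.exp_add]
          push_cast
          ring_nf
      _ ≤ Real.exp (4 * s ^ 3) := by
          apply Real.exp_le_exp.2
          nlinarith [sq_nonneg s]
  refine ⟨p, l ^ d, G, layer, P, hG, le_trans ?_ hp, ?_⟩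
  · calc (n : ℝ) / Real.exp (16 * s ^ 3)
        = n / Real.exp (12 * s ^ 3) / Real.exp (4 * s ^ 3) := by
          rw [div_div, ← Real.exp_add]
          ring_nf
      _ ≤ (l : ℝ) ^ d / (d * l ^ 2) := by gcongr
  · push_cast
    refine le_trans ?_ hld
    gcongr
    norm_num

/-- **Existence of dense DUP graphs (Proposition 4.5).** There are absolute constants
`η_p, η_q > 0` such that for all sufficiently large `n` and any `k` with
`1 ≤ k ≤ 2^((log n)^{1/4})`, there exists a `(p, q, k)`-disjoint-unique-paths graph on
`n` vertices with `p ≥ n / exp(η_p · (ln n)^{3/4})` and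
`q ≥ n / exp(η_q · (ln n)^{3/4})`. -/
theorem dup_graph_exists :
    ∃ ηp > (0 : ℝ), ∃ ηq > (0 : ℝ), ∃ N : ℕ, ∀ n : ℕ, N ≤ n → ∀ k : ℕ, 1 ≤ k →
      (k : ℝ) ≤ 2 ^ ((Real.logb 2 n) ^ ((1 : ℝ) / 4)) →
      ∃ p q : ℕ, ∃ G : SimpleGraph (Fin n), ∃ layer : Fin n → Fin (k + 1),
        ∃ P : Fin q → Fin p → Fin (k + 1) → Fin n,
          IsDUPGraph G layer P ∧
          (n : ℝ) / Real.exp (ηp * (Real.log n) ^ ((3 : ℝ) / 4)) ≤ (p : ℝ) ∧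
          (n : ℝ) / Real.exp (ηq * (Real.log n) ^ ((3 : ℝ) / 4)) ≤ (q : ℝ) := by
  refine ⟨16, by norm_num, 16, by norm_num, ⌈Real.exp (12 ^ 4)⌉₊, fun n hn k _ hk ↦ ?_⟩
  have hn1 : Real.exp (12 ^ 4) ≤ n := Nat.ceil_le.1 hn
  have hn0 : (0 : ℝ) < n := (Real.exp_pos _).trans_le hn1
  have hL : (12 : ℝ) ^ 4 ≤ Real.log n := (Real.le_log_iff_exp_le hn0).2 hn1
  have hL0 : 0 ≤ Real.log n := le_trans (by norm_num) hL
  obtain ⟨s, hs⟩ : ∃ s, s = Real.log n ^ ((1 : ℝ) / 4) := ⟨_, rfl⟩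
  have hs4 : Real.log n = s ^ 4 := by
    rw [hs, ← Real.rpow_natCast, ← Real.rpow_mul hL0]
    norm_num
  have hs0 : 0 ≤ s := hs ▸ Real.rpow_nonneg hL0 _
  have hs3 : Real.log n ^ ((3 : ℝ) / 4) = s ^ 3 := by
    rw [hs, ← Real.rpow_natCast, ← Real.rpow_mul hL0]
    norm_num
  have hs12 : 12 ≤ s := le_of_pow_le_pow_left₀ four_ne_zero hs0 (hs4 ▸ hL)
  have hlog2 : 0 < Real.log 2 := Real.log_pos one_lt_two
  have hlog2' : Real.log 2 ≤ 1 := by linarith [Real.log_two_lt_d9]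
  have hexp : (2 : ℝ) ^ (Real.logb 2 n ^ ((1 : ℝ) / 4)) ≤ Real.exp s := by
    rw [Real.rpow_def_of_pos two_pos, Real.logb, Real.div_rpow hL0 hlog2.le, ← hs]
    apply Real.exp_le_exp.2
    have h1 : Real.log 2 ≤ Real.log 2 ^ ((1 : ℝ) / 4) :=
      Real.self_le_rpow_of_le_one hlog2.le hlog2' (by norm_num)
    rw [mul_div_assoc', div_le_iff₀ (by positivity), mul_comm]
    gcongr
  rw [hs3]
  exact exists_isDUPGraph_of_log_eq hs12 (by exact_mod_cast hn0) hs4 (hk.trans hexp)
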